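/- Let f ∈ L¹_loc(ℝ^d) with weak gradient ∇f ∈ L¹_loc(ℝ^d), and for R > 0 let M_R g(x) = sup_{0 < r ≤ R} (1/Leb(B(x,r))) ∫_{B(x,r)} |g(y)| dy denote the local maximal function. Then there exist a constant C_d > 0 depending only on d and a Lebesgue-negligible set N ⊂ ℝ^d such that for all x, y ∉ N with |x - y| ≤ R, one has |f(x) - f(y)| ≤ C_d |x - y| (M_R|∇f|(x) + M_R|∇f|(y)). -/

import Mathlib

open MeasureTheory

/-- The local maximal function
`M_R g(x) = sup_{0 < r ≤ R} ⨍_{B(x,r)} |g(y)| dy`. -/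
noncomputable def locMaxFn {d : ℕ} (R : ℝ) (g : EuclideanSpace ℝ (Fin d) → ℝ)
    (x : EuclideanSpace ℝ (Fin d)) : ℝ :=
  ⨆ r : Set.Ioc (0 : ℝ) R,
    ((volume (Metric.closedBall x (r : ℝ))).toReal)⁻¹ *
      ∫ y in Metric.closedBall x (r : ℝ), |g y| ∂volume

section LusinLipschitz

open Set Metric Filter Topology

lemma locallyIntegrable_norm {X F : Type*} [TopologicalSpace X] [MeasurableSpace X]
    [NormedAddCommGroup F] {μ : Measure X} {G : X → F} (hG : LocallyIntegrable G μ) :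
    LocallyIntegrable (fun x => ‖G x‖) μ := fun x => by
  obtain ⟨s, hs, h⟩ := hG x
  exact ⟨s, hs, h.norm⟩

variable {E : Type*} [NormedAddCommGroup E] [InnerProductSpace ℝ E] [FiniteDimensional ℝ E]
  [MeasurableSpace E] [BorelSpace E] {μ : Measure E} [μ.IsAddHaarMeasure]
  {F : Type*} [NormedAddCommGroup F] [NormedSpace ℝ F]

lemma measurePreserving_shear (ν : Measure ℝ) [SFinite ν] (v : E) :
    MeasurePreserving (fun p : ℝ × E => (p.1, p.2 + p.1 • v)) (ν.prod μ) (ν.prod μ) :=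
  MeasurePreserving.skew_product (g := fun t x => x + t • v) (MeasurePreserving.id ν)
    (by fun_prop) (Eventually.of_forall fun t => map_add_right_eq_self μ (t • v))

lemma integrable_smul_sub_line {G : E → F} (hG : LocallyIntegrable G μ) {ψ : E → ℝ}
    (hψ : Measurable ψ) {C ρ : ℝ} (hC : ∀ x, |ψ x| ≤ C) (hρ : ∀ x, ρ < ‖x‖ → ψ x = 0) (v : E) :
    Integrable (fun p : ℝ × E => ψ (p.2 - p.1 • v) • G p.2)
      ((volume.restrict (Ioc (0 : ℝ) 1)).prod μ) := by
  have hGi : Integrable ((closedBall (0 : E) (ρ + ‖v‖)).indicator fun x => ‖G x‖) μ :=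
    (integrable_indicator_iff measurableSet_closedBall).2
      (hG.integrableOn_isCompact (isCompact_closedBall _ _)).norm
  refine ((hGi.const_mul C).comp_snd (volume.restrict (Ioc (0 : ℝ) 1))).mono'
    ((hψ.comp (by fun_prop)).aestronglyMeasurable.smul hG.aestronglyMeasurable.comp_snd) ?_
  have hmem : ∀ᵐ t : ℝ ∂volume.restrict (Ioc (0 : ℝ) 1), t ∈ Ioc (0 : ℝ) 1 :=
    ae_restrict_mem measurableSet_Ioc
  filter_upwards [Measure.quasiMeasurePreserving_fst.ae hmem] with p hp
  rw [norm_smul, Real.norm_eq_abs]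
  by_cases hx : p.2 ∈ closedBall (0 : E) (ρ + ‖v‖)
  · rw [indicator_of_mem hx]
    gcongr
    exact hC _
  · rw [indicator_of_notMem hx, hρ, abs_zero, zero_mul, mul_zero]
    rw [mem_closedBall_zero_iff, not_le] at hx
    have h1 : ‖p.1 • v‖ ≤ ‖v‖ := by
      rw [norm_smul, Real.norm_eq_abs, abs_of_pos hp.1]
      exact mul_le_of_le_one_left (norm_nonneg _) hp.2
    have := norm_sub_norm_le p.2 (p.1 • v)
    linarith

lemma integrable_smul_add_line {G : E → F} (hG : LocallyIntegrable G μ) {ψ : E → ℝ}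
    (hψ : Measurable ψ) {C ρ : ℝ} (hC : ∀ x, |ψ x| ≤ C) (hρ : ∀ x, ρ < ‖x‖ → ψ x = 0) (v : E) :
    Integrable (fun p : ℝ × E => ψ p.2 • G (p.2 + p.1 • v))
      ((volume.restrict (Ioc (0 : ℝ) 1)).prod μ) := by
  have h := (measurePreserving_shear (μ := μ) (volume.restrict (Ioc (0 : ℝ) 1))
    v).integrable_comp_of_integrable (integrable_smul_sub_line hG hψ hC hρ v)
  simpa [Function.comp_def] using h

lemma locallyIntegrable_integral_line {G : E → ℝ} (hG : LocallyIntegrable G μ) (v : E) :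
    LocallyIntegrable (fun x => ∫ t in Ioc (0 : ℝ) 1, G (x + t • v)) μ := by
  intro x
  refine ⟨ball x 1, ball_mem_nhds x one_pos, ?_⟩
  have h := (integrable_smul_add_line hG (ψ := (ball x 1).indicator 1) (C := 1) (ρ := ‖x‖ + 1)
    (measurable_one.indicator measurableSet_ball) (fun y => ?_) (fun y hy => ?_) v).integral_prod_right
  · rw [← integrable_indicator_iff measurableSet_ball]
    refine h.congr (Eventually.of_forall fun y => ?_)
    by_cases hy : y ∈ ball x 1 <;> simp [hy]
  · by_cases hy : y ∈ ball x 1 <;> simp [hy]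
  · refine indicator_of_notMem (fun hy' => ?_) _
    rw [mem_ball, dist_eq_norm] at hy'
    have := norm_sub_norm_le y x
    linarith

/-- Integral form of the fundamental theorem of calculus along `v`, for weak gradients. -/
lemma ae_sub_eq_integral_line {f : E → ℝ} {g : E → E} (hf : LocallyIntegrable f μ)
    (hg : LocallyIntegrable g μ)
    (hfg : ∀ φ : E → ℝ, ContDiff ℝ (⊤ : ℕ∞) φ → HasCompactSupport φ →
      ∫ x, f x • gradient φ x ∂μ = -∫ x, φ x • g x ∂μ) (v : E) :
    ∀ᵐ x ∂μ, f (x + v) - f x = ∫ t in Ioc (0 : ℝ) 1, inner ℝ v (g (x + t • v)) := by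
  have hgv : LocallyIntegrable (fun x => inner ℝ v (g x)) μ := fun x => by
    obtain ⟨s, hs, h⟩ := hg x
    exact ⟨s, hs, h.const_inner v⟩
  have hfv : LocallyIntegrable (fun x => f (x + v)) μ := by
    intro x
    obtain ⟨s, hs, h⟩ := hf (x + v)
    refine ⟨(· + v) ⁻¹' s, (continuous_add_const v).continuousAt.preimage_mem_nhds hs, ?_⟩
    exact ((measurePreserving_add_right μ v).integrableOn_comp_preimage
      (measurableEmbedding_addRight v)).2 h
  refine ae_eq_of_integral_contDiff_smul_eq (hfv.sub hf) (locallyIntegrable_integral_line hgv v)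
    fun φ hφ hφc => ?_
  obtain ⟨ρ, hρ⟩ := hφc.isBounded.subset_closedBall (0 : E)
  have hφ0 : ∀ x, ρ < ‖x‖ → φ x = 0 := fun x hx => by
    by_contra h
    have := hρ (subset_tsupport φ h)
    rw [mem_closedBall_zero_iff] at this
    linarith
  have hφ'0 : ∀ x, ρ < ‖x‖ → fderiv ℝ φ x v = 0 := fun x hx => by
    by_contra h
    have h' : fderiv ℝ φ x ≠ 0 := fun h0 => h (by simp [h0])
    have := hρ (support_fderiv_subset ℝ h')
    rw [mem_closedBall_zero_iff] at this
    linarith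
  have hφ'c : Continuous (fun x => fderiv ℝ φ x v) :=
    (hφ.continuous_fderiv (by simp)).clm_apply continuous_const
  obtain ⟨C, hC⟩ := hφ.continuous.bounded_above_of_compact_support hφc
  obtain ⟨C', hC'⟩ := hφ'c.bounded_above_of_compact_support (hφc.fderiv_apply ℝ v)
  have hFTC : ∀ x, φ (x - v) - φ x = -∫ t in Ioc (0 : ℝ) 1, fderiv ℝ φ (x - t • v) v := by
    intro x
    have hd : ∀ t ∈ uIcc (0 : ℝ) 1,
        HasDerivAt (fun t : ℝ => φ (x - t • v)) (-(fderiv ℝ φ (x - t • v) v)) t := fun t _ => by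
      have h1 : HasDerivAt (fun t : ℝ => x - t • v) (-v) t := by
        simpa using ((hasDerivAt_id t).smul_const v).const_sub x
      have := ((hφ.differentiable (by simp)) (x - t • v)).hasFDerivAt.comp_hasDerivAt t h1
      simpa [Function.comp_def] using this
    have := intervalIntegral.integral_eq_sub_of_hasDerivAt hd
      (Continuous.intervalIntegrable (by fun_prop) _ _)
    rw [intervalIntegral.integral_of_le zero_le_one, integral_neg] at this
    simpa using this.symm
  have hweak : ∀ t : ℝ, ∫ x, fderiv ℝ φ (x - t • v) v • f x ∂μ
      = -∫ x, φ (x - t • v) • inner ℝ v (g x) ∂μ := by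
    intro t
    have hs : ContDiff ℝ (⊤ : ℕ∞) (fun x => φ (x - t • v)) := by fun_prop
    have hsc : HasCompactSupport (fun x => φ (x - t • v)) :=
      hφc.comp_homeomorph (Homeomorph.subRight (t • v))
    have h := congrArg (inner ℝ v) (hfg _ hs hsc)
    have hgr : ∀ x, inner ℝ v (gradient (fun x => φ (x - t • v)) x)
        = fderiv ℝ φ (x - t • v) v := fun x => by
      rw [real_inner_comm, gradient, InnerProductSpace.toDual_symm_apply, fderiv_comp_sub]
    have hgc : Continuous (gradient (fun x => φ (x - t • v))) :=
      (InnerProductSpace.toDual ℝ E).symm.continuous.comp (hs.continuous_fderiv (by simp))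
    have hgcs : HasCompactSupport (gradient (fun x => φ (x - t • v))) :=
      (hsc.fderiv ℝ).comp_left (map_zero (InnerProductSpace.toDual ℝ E).symm)
    rw [inner_neg_right, ← integral_inner, ← integral_inner] at h
    · simpa only [inner_smul_right, hgr, smul_eq_mul, mul_comm] using h
    · exact hg.integrable_smul_left_of_hasCompactSupport hs.continuous hsc
    · exact hf.integrable_smul_right_of_hasCompactSupport hgc hgcs
  have hint1 := integrable_smul_sub_line hf hφ'c.measurable (C := C') hC' hφ'0 v
  have hint2 := integrable_smul_add_line hgv hφ.continuous.measurable hC hφ0 v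
  have hφs : HasCompactSupport (fun x => φ (x - v)) :=
    hφc.comp_homeomorph (Homeomorph.subRight v)
  calc ∫ x, φ x • (f (x + v) - f x) ∂μ
      = ∫ x, φ x • f (x + v) ∂μ - ∫ x, φ x • f x ∂μ := by
        simp_rw [smul_sub]
        exact integral_sub (hfv.integrable_smul_left_of_hasCompactSupport hφ.continuous hφc)
          (hf.integrable_smul_left_of_hasCompactSupport hφ.continuous hφc)
    _ = ∫ x, φ (x - v) • f x ∂μ - ∫ x, φ x • f x ∂μ := by
        rw [← integral_add_right_eq_self (fun x => φ (x - v) • f x) v]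
        simp
    _ = ∫ x, (φ (x - v) - φ x) • f x ∂μ := by
        simp_rw [sub_smul]
        exact (integral_sub (hf.integrable_smul_left_of_hasCompactSupport (by fun_prop) hφs)
          (hf.integrable_smul_left_of_hasCompactSupport hφ.continuous hφc)).symm
    _ = -∫ x, (∫ t in Ioc (0 : ℝ) 1, fderiv ℝ φ (x - t • v) v • f x) ∂μ := by
        rw [← integral_neg]
        congr with x
        rw [hFTC, integral_smul_const, neg_smul]
    _ = -∫ t in Ioc (0 : ℝ) 1, ∫ x, fderiv ℝ φ (x - t • v) v • f x ∂μ := by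
        rw [integral_integral_swap (f := fun (t : ℝ) x => fderiv ℝ φ (x - t • v) v • f x) hint1]
    _ = ∫ t in Ioc (0 : ℝ) 1, ∫ x, φ x • inner ℝ v (g (x + t • v)) ∂μ := by
        simp_rw [hweak, integral_neg, neg_neg]
        congr with t
        rw [← integral_add_right_eq_self _ (t • v)]
        simp
    _ = ∫ x, φ x • (∫ t in Ioc (0 : ℝ) 1, inner ℝ v (g (x + t • v))) ∂μ := by
        rw [integral_integral_swap (f := fun (t : ℝ) x => φ x • inner ℝ v (g (x + t • v))) hint2]
        simp_rw [integral_smul]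

/-- For almost every `x`, the increments of a weakly differentiable `f` at `x` are controlled by
the integral of the gradient along segments issued from `x`. -/
lemma ae_ae_enorm_sub_le_lintegral_line {f : E → ℝ} {g : E → E} (hfm : Measurable f)
    (hgm : Measurable g) (hf : LocallyIntegrable f μ) (hg : LocallyIntegrable g μ)
    (hfg : ∀ φ : E → ℝ, ContDiff ℝ (⊤ : ℕ∞) φ → HasCompactSupport φ →
      ∫ x, f x • gradient φ x ∂μ = -∫ x, φ x • g x ∂μ) :
    ∀ᵐ x ∂μ, ∀ᵐ v ∂μ,
      ‖f (x + v) - f x‖ₑ ≤ ‖v‖ₑ * ∫⁻ t in Ioc (0 : ℝ) 1, ‖g (x + t • v)‖ₑ := by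
  have hmeas : Measurable fun p : E × E => ∫⁻ t in Ioc (0 : ℝ) 1, ‖g (p.1 + t • p.2)‖ₑ :=
    Measurable.lintegral_prod_right' (f := fun q : (E × E) × ℝ => ‖g (q.1.1 + q.2 • q.1.2)‖ₑ)
      (hgm.comp (by fun_prop)).enorm
  refine (Measure.ae_ae_comm (p := fun x v => ‖f (x + v) - f x‖ₑ ≤
    ‖v‖ₑ * ∫⁻ t in Ioc (0 : ℝ) 1, ‖g (x + t • v)‖ₑ) (measurableSet_le (by fun_prop) (by fun_prop))).2 ?_
  refine Eventually.of_forall fun v => ?_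
  filter_upwards [ae_sub_eq_integral_line hf hg hfg v] with x hx
  rw [hx, ← lintegral_const_mul _ (by fun_prop)]
  refine (enorm_integral_le_lintegral_enorm _).trans (lintegral_mono fun t => ?_)
  simp_rw [← ofReal_norm]
  rw [← ENNReal.ofReal_mul (norm_nonneg _)]
  exact ENNReal.ofReal_le_ofReal (norm_inner_le_norm v _)

lemma setLIntegral_closedBall_zero_comp_add_smul {G : E → ENNReal} (hG : Measurable G) (x : E)
    {t : ℝ} (ht : 0 < t) (r : ℝ) :
    ∫⁻ v in closedBall (0 : E) r, G (x + t • v) ∂μ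
      = ENNReal.ofReal (t ^ Module.finrank ℝ E)⁻¹ * ∫⁻ y in closedBall x (t * r), G y ∂μ := by
  have hmap : μ.map (fun v => x + t • v) = ENNReal.ofReal (t ^ Module.finrank ℝ E)⁻¹ • μ := by
    have h : (fun v : E => x + t • v) = (x + ·) ∘ (t • ·) := rfl
    rw [h, ← Measure.map_map (by fun_prop) (by fun_prop), Measure.map_addHaar_smul μ ht.ne',
      Measure.map_smul, map_add_left_eq_self, abs_of_pos (by positivity)]
  have hpre : (fun v => x + t • v) ⁻¹' closedBall x (t * r) = closedBall (0 : E) r := by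
    ext v
    simp [mem_closedBall, dist_eq_norm, norm_smul, abs_of_pos ht, ht]
  rw [← hpre, ← setLIntegral_map measurableSet_closedBall hG (by fun_prop), hmap,
    Measure.restrict_smul, lintegral_smul_measure, smul_eq_mul]

lemma setLIntegral_enorm_sub_le {f : E → ℝ} {g : E → E} (hfm : Measurable f) (hgm : Measurable g)
    {x : E} (hx : ∀ᵐ v ∂μ,
      ‖f (x + v) - f x‖ₑ ≤ ‖v‖ₑ * ∫⁻ t in Ioc (0 : ℝ) 1, ‖g (x + t • v)‖ₑ)
    {r : ℝ} (hr : 0 < r) {M : ENNReal}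
    (hM : ∀ s ∈ Ioc (0 : ℝ) r, ∫⁻ y in closedBall x s, ‖g y‖ₑ ∂μ ≤ μ (closedBall x s) * M) :
    ∫⁻ z in closedBall x r, ‖f z - f x‖ₑ ∂μ ≤ ENNReal.ofReal r * (μ (closedBall x r) * M) := by
  have hshift := setLIntegral_closedBall_zero_comp_add_smul (μ := μ)
    (G := fun z => ‖f z - f x‖ₑ) (by fun_prop) x one_pos r
  simp only [one_smul, one_pow, inv_one, ENNReal.ofReal_one, one_mul] at hshift
  have hmeas : Measurable fun p : E × ℝ => ‖g (x + p.2 • p.1)‖ₑ :=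
    (hgm.comp (by fun_prop)).enorm
  calc ∫⁻ z in closedBall x r, ‖f z - f x‖ₑ ∂μ
      = ∫⁻ v in closedBall (0 : E) r, ‖f (x + v) - f x‖ₑ ∂μ := hshift.symm
    _ ≤ ∫⁻ v in closedBall (0 : E) r,
          ENNReal.ofReal r * (∫⁻ t in Ioc (0 : ℝ) 1, ‖g (x + t • v)‖ₑ) ∂μ := by
        refine lintegral_mono_ae ?_
        filter_upwards [ae_restrict_of_ae hx, ae_restrict_mem measurableSet_closedBall]
          with v hv hvr
        refine hv.trans ?_
        gcongr
        rw [← ofReal_norm]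
        exact ENNReal.ofReal_le_ofReal (mem_closedBall_zero_iff.1 hvr)
    _ = ENNReal.ofReal r *
          ∫⁻ t in Ioc (0 : ℝ) 1, ∫⁻ v in closedBall (0 : E) r, ‖g (x + t • v)‖ₑ ∂μ := by
        rw [lintegral_const_mul _ hmeas.lintegral_prod_right',
          lintegral_lintegral_swap hmeas.aemeasurable]
    _ ≤ ENNReal.ofReal r * ∫⁻ _ in Ioc (0 : ℝ) 1, μ (closedBall x r) * M := by
        gcongr ENNReal.ofReal r * ?_
        refine setLIntegral_mono measurable_const fun t ht => ?_
        rw [setLIntegral_closedBall_zero_comp_add_smul (G := fun y => ‖g y‖ₑ) hgm.enorm x ht.1 r]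
        have hs : t * r ∈ Ioc (0 : ℝ) r :=
          ⟨mul_pos ht.1 hr, mul_le_of_le_one_left hr.le ht.2⟩
        have htn : 0 < t ^ Module.finrank ℝ E := pow_pos ht.1 _
        calc _ ≤ ENNReal.ofReal (t ^ Module.finrank ℝ E)⁻¹ * (μ (closedBall x (t * r)) * M) := by
              gcongr
              exact hM _ hs
          _ = μ (closedBall x r) * M := by
              rw [Measure.addHaar_closedBall_mul_of_pos μ x ht.1, ← mul_assoc, ← mul_assoc,
                ← ENNReal.ofReal_mul (by positivity), inv_mul_cancel₀ htn.ne',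
                ENNReal.ofReal_one, one_mul, Measure.addHaar_closedBall_center μ x]
    _ = ENNReal.ofReal r * (μ (closedBall x r) * M) := by simp

/-- The averages of a locally integrable function over small balls centered at almost every point
are bounded. -/
lemma ae_bddAbove_average_closedBall {h : E → ℝ} (hh : LocallyIntegrable h μ) (R : ℝ) :
    ∀ᵐ x ∂μ, BddAbove (range fun r : Ioc (0 : ℝ) R =>
      (μ (closedBall x r)).toReal⁻¹ * ∫ y in closedBall x (r : ℝ), |h y| ∂μ) := by
  filter_upwards [IsUnifLocDoublingMeasure.ae_tendsto_average μ (locallyIntegrable_norm hh) 1] with x hx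
  have hlim := hx (fun _ : ℝ => x) (fun r : ℝ => r) (l := 𝓝[>] 0) tendsto_id (by
    filter_upwards [self_mem_nhdsWithin] with r hr
    exact mem_closedBall_self (by simpa using (le_of_lt hr)))
  have hev := hlim.eventually_lt_const (lt_add_one ‖h x‖)
  obtain ⟨δ, hδ, hδ'⟩ := mem_nhdsGT_iff_exists_Ioo_subset.1 hev
  rw [mem_Ioi] at hδ
  refine ⟨max (‖h x‖ + 1)
    ((μ (closedBall x δ)).toReal⁻¹ * ∫ y in closedBall x R, |h y| ∂μ), ?_⟩
  rintro _ ⟨⟨r, hr0, hrR⟩, rfl⟩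
  rcases lt_or_ge r δ with hrδ | hrδ
  · refine le_max_of_le_left ?_
    have := hδ' ⟨hr0, hrδ⟩
    rw [mem_ofPred_eq, setAverage_eq] at this
    exact this.le
  · refine le_max_of_le_right ?_
    have hpos : 0 < (μ (closedBall x δ)).toReal :=
      ENNReal.toReal_pos (measure_closedBall_pos μ x hδ).ne' measure_closedBall_lt_top.ne
    have hint : IntegrableOn (fun y => |h y|) (closedBall x R) μ :=
      (hh.integrableOn_isCompact (isCompact_closedBall x R)).abs
    refine mul_le_mul ?_ ?_ (integral_nonneg fun y => abs_nonneg _) (inv_nonneg.2 hpos.le)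
    · refine inv_anti₀ hpos (ENNReal.toReal_mono measure_closedBall_lt_top.ne ?_)
      exact measure_mono (closedBall_subset_closedBall hrδ)
    · exact setIntegral_mono_set hint (Eventually.of_forall fun y => abs_nonneg _)
        (closedBall_subset_closedBall hrR).eventuallyLE

lemma enorm_sub_le_of_setLIntegral_le {f : E → ℝ} (hfm : Measurable f) {x y : E} (hxy : x ≠ y)
    {A B : ENNReal}
    (hx : ∫⁻ z in closedBall x (dist x y), ‖f z - f x‖ₑ ∂μ
      ≤ ENNReal.ofReal (dist x y) * (μ (closedBall x (dist x y)) * A))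
    (hy : ∫⁻ z in closedBall y (dist x y), ‖f z - f y‖ₑ ∂μ
      ≤ ENNReal.ofReal (dist x y) * (μ (closedBall y (dist x y)) * B)) :
    ‖f x - f y‖ₑ ≤ ENNReal.ofReal (2 ^ Module.finrank ℝ E * dist x y) * (A + B) := by
  set r := dist x y with hr
  have hrpos : 0 < r := dist_pos.2 hxy
  set W := closedBall (midpoint ℝ x y) (r / 2) with hW
  have hmx : dist (midpoint ℝ x y) x = r / 2 := by
    rw [dist_midpoint_left]; simp; ring
  have hmy : dist (midpoint ℝ x y) y = r / 2 := by
    rw [dist_midpoint_right]; simp; ring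
  have hWx : W ⊆ closedBall x r := closedBall_subset_closedBall' (by linarith)
  have hWy : W ⊆ closedBall y r := closedBall_subset_closedBall' (by linarith)
  have hvol : ∀ z : E, μ (closedBall z r)
      = ENNReal.ofReal (2 ^ Module.finrank ℝ E) * μ W := fun z => by
    rw [hW, Measure.addHaar_closedBall_center μ (midpoint ℝ x y),
      ← Measure.addHaar_closedBall_mul_of_pos μ z two_pos, mul_div_cancel₀ _ two_ne_zero]
  have hW0 : μ W ≠ 0 := (measure_closedBall_pos μ _ (by positivity)).ne'
  have hWtop : μ W ≠ ⊤ := measure_closedBall_lt_top.ne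
  rw [← ENNReal.mul_le_mul_iff_right hW0 hWtop]
  calc μ W * ‖f x - f y‖ₑ = ∫⁻ _ in W, ‖f x - f y‖ₑ ∂μ := by
        rw [setLIntegral_const, mul_comm]
    _ ≤ ∫⁻ z in W, (‖f z - f x‖ₑ + ‖f z - f y‖ₑ) ∂μ := by
        refine lintegral_mono fun z => ?_
        rw [← enorm_neg (f z - f x), neg_sub]
        simpa using enorm_add_le (f x - f z) (f z - f y)
    _ = ∫⁻ z in W, ‖f z - f x‖ₑ ∂μ + ∫⁻ z in W, ‖f z - f y‖ₑ ∂μ :=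
        lintegral_add_left (by fun_prop) _
    _ ≤ ENNReal.ofReal r * (μ (closedBall x r) * A)
          + ENNReal.ofReal r * (μ (closedBall y r) * B) :=
        add_le_add ((lintegral_mono_set hWx).trans hx) ((lintegral_mono_set hWy).trans hy)
    _ = μ W * (ENNReal.ofReal (2 ^ Module.finrank ℝ E * r) * (A + B)) := by
        rw [hvol, hvol, ENNReal.ofReal_mul (by positivity)]
        ring

lemma setLIntegral_enorm_le_locMaxFn {d : ℕ} {R : ℝ}
    {g : EuclideanSpace ℝ (Fin d) → EuclideanSpace ℝ (Fin d)} (hg : LocallyIntegrable g volume)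
    {x : EuclideanSpace ℝ (Fin d)}
    (hx : BddAbove (range fun r : Ioc (0 : ℝ) R =>
      (volume (closedBall x r)).toReal⁻¹ * ∫ y in closedBall x (r : ℝ), |‖g y‖|))
    {s : ℝ} (hs : s ∈ Ioc (0 : ℝ) R) :
    ∫⁻ y in closedBall x s, ‖g y‖ₑ
      ≤ volume (closedBall x s) * ENNReal.ofReal (locMaxFn R (fun z => ‖g z‖) x) := by
  have hle : (volume (closedBall x s)).toReal⁻¹ * ∫ y in closedBall x s, |‖g y‖|
      ≤ locMaxFn R (fun z => ‖g z‖) x := le_ciSup hx ⟨s, hs⟩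
  have htop : volume (closedBall x s) ≠ ⊤ := measure_closedBall_lt_top.ne
  have hpos : 0 < (volume (closedBall x s)).toReal :=
    ENNReal.toReal_pos (measure_closedBall_pos volume x hs.1).ne' htop
  rw [inv_mul_le_iff₀ hpos] at hle
  simp only [abs_norm] at hle
  rw [← ofReal_integral_norm_eq_lintegral_enorm
    (hg.integrableOn_isCompact (isCompact_closedBall x s))]
  refine (ENNReal.ofReal_le_ofReal hle).trans_eq ?_
  rw [ENNReal.ofReal_mul hpos.le, ENNReal.ofReal_toReal htop]

lemma locMaxFn_nonneg {d : ℕ} (R : ℝ) (g : EuclideanSpace ℝ (Fin d) → ℝ)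
    (x : EuclideanSpace ℝ (Fin d)) : 0 ≤ locMaxFn R g x :=
  Real.iSup_nonneg fun _ => mul_nonneg (inv_nonneg.2 ENNReal.toReal_nonneg)
    (integral_nonneg fun _ => abs_nonneg _)

lemma locMaxFn_congr_ae {d : ℕ} (R : ℝ) {g g' : EuclideanSpace ℝ (Fin d) → ℝ}
    (h : g =ᵐ[volume] g') : locMaxFn R g = locMaxFn R g' := by
  ext x
  refine iSup_congr fun r => ?_
  congr 1
  refine integral_congr_ae (ae_restrict_of_ae ?_)
  filter_upwards [h] with y hy
  rw [hy]

end LusinLipschitz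

/-- Crippa–De Lellis Lusin–Lipschitz estimate: if `f ∈ W^{1,1}_loc(ℝ^d)` with weak
gradient `g`, then off a negligible set `N`, for `|x - y| ≤ R`,
`|f(x) - f(y)| ≤ C_d |x - y| (M_R|∇f|(x) + M_R|∇f|(y))`. -/
theorem lusin_lipschitz_estimate (d : ℕ) :
    ∃ C > (0 : ℝ), ∀ R > (0 : ℝ),
      ∀ (f : EuclideanSpace ℝ (Fin d) → ℝ) (g : EuclideanSpace ℝ (Fin d) → EuclideanSpace ℝ (Fin d)),
        LocallyIntegrable f volume → LocallyIntegrable g volume →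
        (∀ φ : EuclideanSpace ℝ (Fin d) → ℝ, ContDiff ℝ (⊤ : ℕ∞) φ → HasCompactSupport φ →
          ∫ x, f x • gradient φ x ∂volume = -∫ x, φ x • g x ∂volume) →
        ∃ N : Set (EuclideanSpace ℝ (Fin d)), volume N = 0 ∧
          ∀ x y, x ∉ N → y ∉ N → dist x y ≤ R →
            |f x - f y| ≤ C * dist x y *
              (locMaxFn R (fun z => ‖g z‖) x + locMaxFn R (fun z => ‖g z‖) y) := by
  refine ⟨2 ^ d, by positivity, fun R _ f g hf hg hfg => ?_⟩
  obtain ⟨f', hf'm, hff'⟩ := hf.aestronglyMeasurable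
  obtain ⟨g', hg'm, hgg'⟩ := hg.aestronglyMeasurable
  have hf' : LocallyIntegrable f' volume := hf.congr hff'
  have hg' : LocallyIntegrable g' volume := hg.congr hgg'
  have hfg' : ∀ φ : EuclideanSpace ℝ (Fin d) → ℝ, ContDiff ℝ (⊤ : ℕ∞) φ → HasCompactSupport φ →
      ∫ x, f' x • gradient φ x = -∫ x, φ x • g' x := fun φ hφ hφc => by
    rw [← integral_congr_ae (hff'.smul (.refl _ (gradient φ))),
      ← integral_congr_ae ((Filter.EventuallyEq.refl _ φ).smul hgg')]
    exact hfg φ hφ hφc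
  have hgood : ∀ᵐ x, f x = f' x ∧ ∀ r ∈ Set.Ioc (0 : ℝ) R,
      ∫⁻ z in Metric.closedBall x r, ‖f' z - f' x‖ₑ ≤ ENNReal.ofReal r *
        (volume (Metric.closedBall x r) *
          ENNReal.ofReal (locMaxFn R (fun z => ‖g' z‖) x)) := by
    filter_upwards [hff', ae_ae_enorm_sub_le_lintegral_line hf'm.measurable hg'm.measurable
      hf' hg' hfg', ae_bddAbove_average_closedBall (locallyIntegrable_norm hg') R] with x hx hline hbdd
    exact ⟨hx, fun r hr => setLIntegral_enorm_sub_le hf'm.measurable hg'm.measurable hline hr.1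
      fun s hs => setLIntegral_enorm_le_locMaxFn hg' hbdd ⟨hs.1, hs.2.trans hr.2⟩⟩
  refine ⟨_, hgood, fun x y hx hy hxy => ?_⟩
  obtain ⟨hfx, hx⟩ := not_not.1 hx
  obtain ⟨hfy, hy⟩ := not_not.1 hy
  rcases eq_or_ne x y with rfl | hne
  · simp
  have hr : dist x y ∈ Set.Ioc (0 : ℝ) R := ⟨dist_pos.2 hne, hxy⟩
  have h := enorm_sub_le_of_setLIntegral_le hf'm.measurable hne (hx _ hr) (hy _ hr)
  rw [← ENNReal.ofReal_add (locMaxFn_nonneg _ _ _) (locMaxFn_nonneg _ _ _),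
    ← ENNReal.ofReal_mul (by positivity), Real.enorm_eq_ofReal_abs,
    ENNReal.ofReal_le_ofReal_iff (mul_nonneg (by positivity)
      (add_nonneg (locMaxFn_nonneg _ _ _) (locMaxFn_nonneg _ _ _))),
    finrank_euclideanSpace_fin] at h
  rwa [hfx, hfy, locMaxFn_congr_ae R (g := fun z => ‖g z‖) (hgg'.fun_comp norm)]
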